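/- A metric space X is doubling if and only if for every K > 1 there exists N ∈ ℕ such that X contains no (N,K)-clique. Equivalently: X is not doubling if and only if X is K-cliquey for some (equivalently, every) K > 1. -/

import Mathlib

open Metric

def IsDoubling (X : Type*) [MetricSpace X] : Prop :=
  ∃ M : ℕ, ∀ (x : X) (R : ℝ), 0 < R → ∃ s : Finset X,
    s.card ≤ M ∧ ball x R ⊆ ⋃ y ∈ s, ball y (R / 2)

def IsNKClique {X : Type*} [MetricSpace X] (N : ℕ) (K : ℝ) (x : Fin N → X) : Prop :=
  Function.Injective x ∧ ∀ i j k l : Fin N, i ≠ j → k ≠ l →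
    dist (x i) (x j) ≤ K * dist (x k) (x l)

def IsCliquey (X : Type*) [MetricSpace X] (K : ℝ) : Prop :=
  ∀ N : ℕ, ∃ x : Fin N → X, IsNKClique N K x

theorem ramsey_two {X : Type*} :
    ∀ m s t : ℕ, s + t = m → ∃ n : ℕ, ∀ (r : X → X → Prop), (∀ x y, r x y → r y x) →
      ∀ S : Finset X, n ≤ S.card →
      (∃ T ⊆ S, T.card = s ∧ ∀ x ∈ T, ∀ y ∈ T, x ≠ y → r x y) ∨
      (∃ T ⊆ S, T.card = t ∧ ∀ x ∈ T, ∀ y ∈ T, x ≠ y → ¬ r x y) := by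
  classical
  intro m
  induction m with
  | zero =>
    intro s t h
    exact ⟨0, fun _ _ S _ => Or.inl ⟨∅, by simp, by simp; omega, by simp⟩⟩
  | succ m ih =>
    intro s t h
    rcases s with _ | s
    · exact ⟨0, fun _ _ S _ => Or.inl ⟨∅, by simp, by simp, by simp⟩⟩
    rcases t with _ | t
    · exact ⟨0, fun _ _ S _ => Or.inr ⟨∅, by simp, by simp, by simp⟩⟩
    obtain ⟨n1, h1⟩ := ih s (t+1) (by omega)
    obtain ⟨n2, h2⟩ := ih (s+1) t (by omega)
    refine ⟨n1 + n2 + 1, fun r hr S hS => ?_⟩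
    obtain ⟨v, hv⟩ : S.Nonempty := Finset.card_pos.mp (by omega)
    have hc := Finset.card_filter_add_card_filter_not (s := S.erase v) (fun y => r v y)
    have he := Finset.card_erase_of_mem hv
    have hcase : n1 ≤ ((S.erase v).filter (fun y => r v y)).card ∨
        n2 ≤ ((S.erase v).filter (fun y => ¬ r v y)).card := by omega
    rcases hcase with hcase | hcase
    · rcases h1 r hr _ hcase with ⟨T, hT, hcard, hp⟩ | ⟨T, hT, hcard, hp⟩
      · left
        have hTv : ∀ y ∈ T, y ≠ v ∧ y ∈ S ∧ r v y := by
          intro y hy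
          have := hT hy
          simp at this
          tauto
        refine ⟨insert v T, ?_, ?_, ?_⟩
        · intro y hy
          rcases Finset.mem_insert.mp hy with rfl | hy
          · exact hv
          · exact (hTv y hy).2.1
        · rw [Finset.card_insert_of_notMem (fun h => (hTv v h).1 rfl), hcard]
        · intro x hx y hy hxy
          rcases Finset.mem_insert.mp hx with hxv | hx1 <;>
          rcases Finset.mem_insert.mp hy with hyv | hy1
          · exact absurd (hxv.trans hyv.symm) hxy
          · rw [hxv]; exact (hTv y hy1).2.2
          · rw [hyv]; exact hr _ _ (hTv x hx1).2.2
          · exact hp x hx1 y hy1 hxy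
      · right
        exact ⟨T, hT.trans ((Finset.filter_subset _ _).trans (Finset.erase_subset _ _)), hcard, hp⟩
    · rcases h2 r hr _ hcase with ⟨T, hT, hcard, hp⟩ | ⟨T, hT, hcard, hp⟩
      · left
        exact ⟨T, hT.trans ((Finset.filter_subset _ _).trans (Finset.erase_subset _ _)), hcard, hp⟩
      · right
        have hTv : ∀ y ∈ T, y ≠ v ∧ y ∈ S ∧ ¬ r v y := by
          intro y hy
          have := hT hy
          simp at this
          tauto
        refine ⟨insert v T, ?_, ?_, ?_⟩
        · intro y hy
          rcases Finset.mem_insert.mp hy with rfl | hy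
          · exact hv
          · exact (hTv y hy).2.1
        · rw [Finset.card_insert_of_notMem (fun h => (hTv v h).1 rfl), hcard]
        · intro x hx y hy hxy
          rcases Finset.mem_insert.mp hx with hxv | hx1 <;>
          rcases Finset.mem_insert.mp hy with hyv | hy1
          · exact absurd (hxv.trans hyv.symm) hxy
          · rw [hxv]; exact (hTv y hy1).2.2
          · rw [hyv]; exact fun h => (hTv x hx1).2.2 (hr _ _ h)
          · exact hp x hx1 y hy1 hxy

/-- Finset form of being cliquey. -/
def CliqueyFin (X : Type*) [MetricSpace X] (K : ℝ) : Prop :=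
  ∀ N : ℕ, ∃ T : Finset X, T.card = N ∧ ∃ a : ℝ, 0 < a ∧
    ∀ x ∈ T, ∀ y ∈ T, x ≠ y → a ≤ dist x y ∧ dist x y ≤ K * a

theorem CliqueyFin.sqrt {X : Type*} [MetricSpace X] {K : ℝ} (hK : 1 < K)
    (h : CliqueyFin X (K ^ 2)) : CliqueyFin X K := by
  intro N
  by_contra hcon
  push Not at hcon
  obtain ⟨n, hn⟩ := ramsey_two (X := X) _ N N rfl
  obtain ⟨S, hS, a, ha, hd⟩ := h n
  rcases hn (fun x y => dist x y ≤ K * a) (fun x y h => by rwa [dist_comm]) S hS.ge with ⟨T, hT, hc, hp⟩ | ⟨T, hT, hc, hp⟩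
  · obtain ⟨x, hx, y, hy, hxy, h1⟩ := hcon T hc a ha
    have h2 := hd x (hT hx) y (hT hy) hxy
    have h3 := hp x hx y hy hxy
    linarith [h1 h2.1]
  · obtain ⟨x, hx, y, hy, hxy, h1⟩ := hcon T hc (K * a) (by positivity)
    have h2 := hd x (hT hx) y (hT hy) hxy
    have h3 := hp x hx y hy hxy
    push Not at h3
    have := h1 h3.le
    nlinarith [h2.2]

theorem CliqueyFin.root {X : Type*} [MetricSpace X] (n : ℕ) : ∀ {K : ℝ}, 1 < K →
    CliqueyFin X (K ^ (2 ^ n)) → CliqueyFin X K := by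
  induction n with
  | zero => intro K _ h; simpa using h
  | succ n ih =>
    intro K hK h
    apply CliqueyFin.sqrt hK
    apply ih (by nlinarith)
    rwa [← pow_mul, ← pow_succ']

theorem CliqueyFin.cliquey {X : Type*} [MetricSpace X] {K : ℝ} (hK : 1 < K)
    (h : CliqueyFin X K) : IsCliquey X K := by
  intro N
  obtain ⟨T, hT, a, ha, hd⟩ := h N
  let e := (Finset.equivFinOfCardEq hT).symm
  have hne : ∀ {i j : Fin N}, i ≠ j → (e i : X) ≠ e j := fun hij h =>
    hij (e.injective (Subtype.ext h))
  refine ⟨fun i => (e i : X), fun i j hij => e.injective (Subtype.ext hij), ?_⟩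
  intro i j k l hij hkl
  have h1 := hd _ (e i).2 _ (e j).2 (hne hij)
  have h2 := hd _ (e k).2 _ (e l).2 (hne hkl)
  exact h1.2.trans (mul_le_mul_of_nonneg_left h2.1 (by linarith))

theorem cliqueyFin_four {X : Type*} [MetricSpace X] (h : ¬ IsDoubling X) : CliqueyFin X 4 := by
  classical
  intro N
  unfold IsDoubling at h
  push Not at h
  obtain ⟨x, R, hR, hcov⟩ := h N
  have key : ∀ k ≤ N, ∃ T : Finset X, T.card = k ∧ (∀ y ∈ T, y ∈ ball x R) ∧
      ∀ y ∈ T, ∀ z ∈ T, y ≠ z → R / 2 ≤ dist y z := by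
    intro k
    induction k with
    | zero => intro _; exact ⟨∅, by simp⟩
    | succ k ih =>
      intro hk
      obtain ⟨T, hc, hb, hs⟩ := ih (by omega)
      obtain ⟨p, hp, hpn⟩ := Set.not_subset.mp (hcov T (by omega))
      simp only [Set.mem_iUnion, mem_ball, not_exists, not_lt] at hpn
      refine ⟨insert p T, ?_, ?_, ?_⟩
      · rw [Finset.card_insert_of_notMem, hc]
        intro hpT
        have := hpn p hpT
        rw [dist_self] at this
        linarith
      · intro y hy
        rcases Finset.mem_insert.mp hy with rfl | hy
        · exact hp
        · exact hb y hy
      · intro y hy z hz hyz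
        rcases Finset.mem_insert.mp hy with hyp | hy1 <;>
        rcases Finset.mem_insert.mp hz with hzp | hz1
        · exact absurd (hyp.trans hzp.symm) hyz
        · rw [hyp]; exact hpn z hz1
        · rw [hzp, dist_comm]; exact hpn y hy1
        · exact hs y hy1 z hz1 hyz
  obtain ⟨T, hc, hb, hs⟩ := key N le_rfl
  refine ⟨T, hc, R / 2, by positivity, fun y hy z hz hyz => ⟨hs y hy z hz hyz, ?_⟩⟩
  have h1 := mem_ball.mp (hb y hy)
  have h2 := mem_ball.mp (hb z hz)
  have := dist_triangle_right y z x
  linarith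

theorem cliquey_of_not_doubling {X : Type*} [MetricSpace X] (h : ¬ IsDoubling X)
    (K : ℝ) (hK : 1 < K) : IsCliquey X K := by
  obtain ⟨n, hn⟩ := pow_unbounded_of_one_lt 4 hK
  have h4 : (4 : ℝ) ≤ K ^ (2 ^ n) :=
    hn.le.trans (pow_le_pow_right₀ hK.le (Nat.lt_two_pow_self).le)
  apply CliqueyFin.cliquey hK
  apply CliqueyFin.root n hK
  intro N
  obtain ⟨T, hT, a, ha, hd⟩ := cliqueyFin_four h N
  exact ⟨T, hT, a, ha, fun x hx y hy hxy => ⟨(hd x hx y hy hxy).1,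
    (hd x hx y hy hxy).2.trans (mul_le_mul_of_nonneg_right h4 ha.le)⟩⟩

theorem no_clique_of_doubling {X : Type*} [MetricSpace X] (h : IsDoubling X)
    (K : ℝ) (hK : 1 < K) : ∃ N : ℕ, ¬ ∃ x : Fin N → X, IsNKClique N K x := by
  classical
  obtain ⟨M, hM⟩ := h
  have iter : ∀ n : ℕ, ∀ (x : X) (R : ℝ), 0 < R → ∃ s : Finset X,
      s.card ≤ M ^ n ∧ ball x R ⊆ ⋃ y ∈ s, ball y (R / 2 ^ n) := by
    intro n
    induction n with
    | zero => intro x R _; exact ⟨{x}, by simp⟩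
    | succ n ih =>
      intro x R hR
      obtain ⟨s, hs, hcov⟩ := ih x R hR
      choose f hf using fun y : X => hM y (R / 2 ^ n) (by positivity)
      refine ⟨s.biUnion f, ?_, ?_⟩
      · calc _ ≤ s.card * M := Finset.card_biUnion_le_card_mul _ _ _ (fun y _ => (hf y).1)
          _ ≤ M ^ n * M := Nat.mul_le_mul_right _ hs
          _ = M ^ (n+1) := (pow_succ _ _).symm
      · intro p hp
        obtain ⟨y, hy, hpy⟩ := Set.mem_iUnion₂.mp (hcov hp)
        obtain ⟨z, hz, hpz⟩ := Set.mem_iUnion₂.mp ((hf y).2 hpy)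
        refine Set.mem_iUnion₂.mpr ⟨z, Finset.mem_biUnion.mpr ⟨y, hy, hz⟩, ?_⟩
        rwa [pow_succ, ← div_div]
  obtain ⟨n, hn⟩ := pow_unbounded_of_one_lt (4 * K ^ 2) (one_lt_two (α := ℝ))
  refine ⟨M ^ n + 2, ?_⟩
  rintro ⟨x, hinj, hx⟩
  have h01 : (0 : Fin (M ^ n + 2)) ≠ 1 := by simp
  set a := dist (x 0) (x 1) with ha
  have hapos : 0 < a := dist_pos.mpr (hinj.ne h01)
  obtain ⟨s, hs, hcov⟩ := iter n (x 0) (2 * K * a) (by positivity)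
  have hmem : ∀ i, ∃ y ∈ s, x i ∈ ball y (2 * K * a / 2 ^ n) := by
    intro i
    have : x i ∈ ball (x 0) (2 * K * a) := by
      rw [mem_ball]
      by_cases hi : i = 0
      · rw [hi, dist_self]; positivity
      · have := hx i 0 0 1 hi h01
        rw [← ha] at this
        nlinarith
    obtain ⟨y, hy, hyx⟩ := Set.mem_iUnion₂.mp (hcov this)
    exact ⟨y, hy, hyx⟩
  choose g hg hgx using hmem
  obtain ⟨i, -, j, -, hij, hgij⟩ := Finset.exists_ne_map_eq_of_card_lt_of_maps_to
    (s := Finset.univ) (t := s) (f := g) (by rw [Finset.card_fin]; omega) (fun i _ => hg i)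
  have h1 := mem_ball.mp (hgx i)
  have h2 := mem_ball.mp (hgx j)
  rw [← hgij] at h2
  have h3 := dist_triangle_right (x i) (x j) (g i)
  have h4 := hx 0 1 i j h01 hij
  rw [← ha] at h4
  have h5 : 2 * K * a / 2 ^ n * (2 * K) ≤ a := by
    rw [div_mul_eq_mul_div, div_le_iff₀ (by positivity)]
    nlinarith
  nlinarith

/-- `X` is doubling iff for every `K > 1` there is `N` such that `X` contains no
`(N,K)`-clique; equivalently, `X` is not doubling iff it is `K`-cliquey for some
(equivalently, every) `K > 1`. -/
theorem doubling_iff_no_cliques (X : Type*) [MetricSpace X] :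
    (IsDoubling X ↔ ∀ K : ℝ, 1 < K → ∃ N : ℕ, ¬ ∃ x : Fin N → X, IsNKClique N K x) ∧
    (¬ IsDoubling X ↔ ∃ K : ℝ, 1 < K ∧ IsCliquey X K) ∧
    (¬ IsDoubling X ↔ ∀ K : ℝ, 1 < K → IsCliquey X K) := by
  have hA : ∀ K : ℝ, 1 < K → IsCliquey X K → ¬ IsDoubling X := by
    intro K hK hc hd
    obtain ⟨N, hN⟩ := no_clique_of_doubling hd K hK
    exact hN (hc N)
  refine ⟨⟨fun h K hK => no_clique_of_doubling h K hK, fun h => ?_⟩,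
    ⟨fun h => ⟨2, one_lt_two, cliquey_of_not_doubling h 2 one_lt_two⟩, ?_⟩,
    ⟨fun h => cliquey_of_not_doubling h, fun h => hA 2 one_lt_two (h 2 one_lt_two)⟩⟩
  · by_contra hnd
    obtain ⟨N, hN⟩ := h 2 one_lt_two
    exact hN (cliquey_of_not_doubling hnd 2 one_lt_two N)
  · rintro ⟨K, hK, hc⟩
    exact hA K hK hc
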